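/- arXiv:1801.09778 — 3 statements merged into one kernel-verified Lean document; each statement's English description precedes it below -/
import Mathlib

section
/- Assume ρ and γ are continuous, the kernel k is positive semidefinite (Q(ν) ≥ 0 for every signed discrete varifold ν), the kernel defined by ρ is C₀-universal, γ is an even function (γ(−u) = γ(u) for all u ∈ [−1,1]), γ(1) > 0, and γ(u) < γ(1) for all u ∈ (−1,1). Then ‖·‖_{W*} induces a metric on 𝒟̊ modulo orientation: for any two discrete varifolds μ = Σ_{i=1}^N r_i δ_{(x_i,d_i)} and μ' = Σ_{j=1}^M r_j' δ_{(x_j',d_j')} in 𝒟̊, if Q(μ−μ') = 0, then N = M and there is a permutation σ of {1,…,N} such that for every i: x_{σ(i)}' = x_i, r_{σ(i)}' = r_i, and d_{σ(i)}' = d_i or d_{σ(i)}' = −d_i. -/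
open scoped RealInnerProductSpace

noncomputable section

/-- `ℝⁿ` as a Euclidean space. -/
abbrev Euc (n : ℕ) : Type := EuclideanSpace ℝ (Fin n)

/-- The separable kernel `k((x,d),(x',d')) = ρ(|x-x'|²) γ(⟨d,d'⟩)` on `ℝⁿ × S^{n-1}`. -/
def kerF (n : ℕ) (ρ γ : ℝ → ℝ) (a b : Euc n × Euc n) : ℝ :=
  ρ (‖a.1 - b.1‖ ^ 2) * γ ⟪a.2, b.2⟫

/-- Kernel quadratic form of a finite family of atoms `a i` with coefficients `c i`:
`Q = Σ_{i,j} c i c j k(a i, a j)`. By bilinearity this computes `Q(μ-μ')` when the family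
is the disjoint union of the atoms of `μ` and `μ'` with coefficients `rᵢ` and `-rⱼ'`. -/
def QformF {n : ℕ} (ρ γ : ℝ → ℝ) {ι : Type} [Fintype ι]
    (a : ι → Euc n × Euc n) (c : ι → ℝ) : ℝ :=
  ∑ i, ∑ j, c i * c j * kerF n ρ γ (a i) (a j)

/-- Combining atoms at equal positions does not change a kernel double sum. -/
lemma sum_sum_fiberwise_image {ι α : Type*} [Fintype ι] [DecidableEq α]
    (a : ι → α) (c : ι → ℝ) (K : α → α → ℝ) :
    ∑ i, ∑ j, c i * c j * K (a i) (a j) =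
      ∑ p ∈ Finset.univ.image a, ∑ q ∈ Finset.univ.image a,
        (∑ i with a i = p, c i) * (∑ j with a j = q, c j) * K p q := by
  have h (f : ι → α → ℝ) : ∑ i, f i (a i) =
      ∑ p ∈ Finset.univ.image a, ∑ i with a i = p, f i p := by
    rw [← Finset.sum_fiberwise_of_maps_to (s := Finset.univ) (t := Finset.univ.image a) (g := a)
      (fun i _ => Finset.mem_image_of_mem a (Finset.mem_univ i))]
    refine Finset.sum_congr rfl fun p _ => Finset.sum_congr rfl fun i hi => ?_
    rw [(Finset.mem_filter.mp hi).2]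
  rw [h fun i p => ∑ j, c i * c j * K p (a j)]
  refine Finset.sum_congr rfl fun p _ => ?_
  simp_rw [fun i => h fun j q => c i * c j * K p q]
  rw [Finset.sum_comm]
  refine Finset.sum_congr rfl fun q _ => ?_
  simp_rw [Finset.sum_mul_sum, Finset.sum_mul]

/-- Positive semidefiniteness on injective families extends to arbitrary finite families. -/
lemma QformF_nonneg {n : ℕ} {ρ γ : ℝ → ℝ}
    (hpsd : ∀ (P : ℕ) (a : Fin P → Euc n × Euc n) (c : Fin P → ℝ),
        (∀ i, ‖(a i).2‖ = 1) → Function.Injective a → 0 ≤ QformF ρ γ a c)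
    {ι : Type} [Fintype ι] (a : ι → Euc n × Euc n) (c : ι → ℝ) (ha : ∀ i, ‖(a i).2‖ = 1) :
    0 ≤ QformF ρ γ a c := by
  classical
  set S := Finset.univ.image a with hS
  have key := hpsd S.card (fun k => (S.equivFin.symm k : Euc n × Euc n))
    (fun k => ∑ i with a i = (S.equivFin.symm k : Euc n × Euc n), c i)
    (fun k => by
      obtain ⟨i, -, hi⟩ := Finset.mem_image.mp (S.equivFin.symm k).2
      exact hi ▸ ha i)
    (Subtype.val_injective.comp S.equivFin.symm.injective)
  refine key.trans_eq ?_
  rw [QformF, QformF, sum_sum_fiberwise_image a, ← hS, ← Finset.sum_coe_sort S,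
    ← S.equivFin.symm.sum_comp]
  refine Finset.sum_congr rfl fun k _ => ?_
  rw [← Finset.sum_coe_sort S, ← S.equivFin.symm.sum_comp]

lemma kerF_comm {n : ℕ} (ρ γ : ℝ → ℝ) (a b : Euc n × Euc n) :
    kerF n ρ γ a b = kerF n ρ γ b a := by
  rw [kerF, kerF, norm_sub_rev, real_inner_comm]

/-- A null vector of a positive semidefinite kernel form is orthogonal to every atom. -/
lemma sum_mul_kerF_eq_zero {n : ℕ} {ρ γ : ℝ → ℝ}
    (hpsd : ∀ (P : ℕ) (a : Fin P → Euc n × Euc n) (c : Fin P → ℝ),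
        (∀ i, ‖(a i).2‖ = 1) → Function.Injective a → 0 ≤ QformF ρ γ a c)
    {ι : Type} [Fintype ι] (a : ι → Euc n × Euc n) (c : ι → ℝ) (ha : ∀ i, ‖(a i).2‖ = 1)
    (hQ : QformF ρ γ a c = 0) (b : Euc n × Euc n) (hb : ‖b.2‖ = 1) :
    ∑ i, c i * kerF n ρ γ (a i) b = 0 := by
  set B := ∑ i, c i * kerF n ρ γ (a i) b with hB
  have key (t : ℝ) : 0 ≤ 2 * t * B + kerF n ρ γ b b := by
    have h := QformF_nonneg hpsd (fun o : Option ι => o.elim b a)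
      (fun o : Option ι => o.elim 1 fun i => t * c i) (by rintro (_ | i) <;> simp [ha, hb])
    have h₁ : ∑ i, t * c i * kerF n ρ γ (a i) b = t * B := by
      rw [hB, Finset.mul_sum]
      exact Finset.sum_congr rfl fun i _ => by ring
    have h₂ : ∑ i, ∑ j, t * c i * (t * c j) * kerF n ρ γ (a i) (a j) = 0 := by
      rw [← mul_zero (t ^ 2), ← hQ, QformF, Finset.mul_sum]
      refine Finset.sum_congr rfl fun i _ => ?_
      rw [Finset.mul_sum]
      exact Finset.sum_congr rfl fun j _ => by ring
    simp only [QformF, Fintype.sum_option, Option.elim_none, Option.elim_some, one_mul, mul_one,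
      Finset.sum_add_distrib, h₁, h₂, kerF_comm ρ γ b (a _)] at h
    linarith
  by_contra hne
  have h := key (-(kerF n ρ γ b b + 1) / (2 * B))
  have h' : 2 * (-(kerF n ρ γ b b + 1) / (2 * B)) * B = -(kerF n ρ γ b b + 1) := by
    field_simp
  linarith

/-- If the translates of `ρ(|·|²)` span a dense subspace of `C₀`, a finite combination of Dirac
masses annihilating all of them has zero total mass at each point. -/
lemma sum_indicator_eq_zero_of_universal {n : ℕ} {ρ : ℝ → ℝ}
    (huniv : Dense (X := ZeroAtInftyContinuousMap (Euc n) ℝ)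
        (Submodule.span ℝ {g : ZeroAtInftyContinuousMap (Euc n) ℝ |
            ∃ y : Euc n, ∀ x : Euc n, g x = ρ (‖x - y‖ ^ 2)} : Set _))
    {ι : Type*} [Fintype ι] (x : ι → Euc n) (w : ι → ℝ)
    (h : ∀ y, ∑ i, w i * ρ (‖x i - y‖ ^ 2) = 0) (z : Euc n) :
    ∑ i, Set.indicator {z} (fun _ => w i) (x i) = 0 := by
  have hall (g : ZeroAtInftyContinuousMap (Euc n) ℝ) : ∑ i, w i * g (x i) = 0 := by
    have hcl : IsClosed {g : ZeroAtInftyContinuousMap (Euc n) ℝ | ∑ i, w i * g (x i) = 0} := by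
      refine isClosed_eq (continuous_finsetSum _ fun i _ => continuous_const.mul ?_)
        continuous_const
      exact (continuous_eval_const (F := BoundedContinuousFunction (Euc n) ℝ) (x i)).comp
        ZeroAtInftyContinuousMap.isometry_toBCF.continuous
    refine hcl.closure_subset_iff.mpr (fun g hg => ?_) (huniv g)
    refine Submodule.span_induction (p := fun g _ => ∑ i, w i * g (x i) = 0) ?_ ?_ ?_ ?_ hg
    · rintro g ⟨y, hy⟩
      simpa only [hy] using h y
    · simp
    · intro f g _ _ hf hg
      simp only [ZeroAtInftyContinuousMap.coe_add, Pi.add_apply, mul_add, Finset.sum_add_distrib,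
        hf, hg, add_zero]
    · intro t g _ hg
      simp only [ZeroAtInftyContinuousMap.coe_smul, Pi.smul_apply, smul_eq_mul,
        mul_left_comm _ t, ← Finset.mul_sum, hg, mul_zero]
  obtain ⟨f, hf1, hf0, hfc, -⟩ := exists_continuous_one_zero_of_isCompact
    (isCompact_singleton (x := z)) ((Set.finite_range x).subset Set.sdiff_subset).isClosed
    (t := Set.range x \ {z}) Set.disjoint_sdiff_right
  have hf : ∑ i, w i * f (x i) = 0 := hall ⟨f, hfc.is_zero_at_infty⟩
  rw [← hf]
  refine Finset.sum_congr rfl fun i _ => ?_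
  by_cases hi : x i = z
  · simp [hi, hf1 (Set.mem_singleton z)]
  · simp [hi, hf0 (show x i ∈ Set.range x \ {z} from ⟨⟨i, rfl⟩, hi⟩)]

lemma le_of_even_of_lt {γ : ℝ → ℝ} (hγeven : ∀ u : ℝ, -1 ≤ u → u ≤ 1 → γ (-u) = γ u)
    (hγlt : ∀ u : ℝ, -1 < u → u < 1 → γ u < γ 1) {t : ℝ} (h₁ : -1 ≤ t) (h₂ : t ≤ 1) :
    γ t ≤ γ 1 := by
  rcases h₁.eq_or_lt with rfl | h₁
  · exact (hγeven 1 (by norm_num) le_rfl).le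
  rcases h₂.eq_or_lt with rfl | h₂
  · exact le_rfl
  · exact (hγlt t h₁ h₂).le

/-- Two atoms inducing the same profile on the sphere have equal weights and equal axes. -/
lemma eq_weight_and_axis {n : ℕ} {γ : ℝ → ℝ}
    (hγeven : ∀ u : ℝ, -1 ≤ u → u ≤ 1 → γ (-u) = γ u)
    (hγ1 : 0 < γ 1) (hγlt : ∀ u : ℝ, -1 < u → u < 1 → γ u < γ 1)
    {d u : Euc n} {r s : ℝ} (hd : ‖d‖ = 1) (hu : ‖u‖ = 1) (hr : 0 < r) (hs : 0 < s)
    (h : ∀ e : Euc n, ‖e‖ = 1 → r * γ ⟪d, e⟫ = s * γ ⟪u, e⟫) :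
    s = r ∧ (u = d ∨ u = -d) := by
  have habs : |⟪u, d⟫| ≤ 1 := by simpa [hd, hu] using abs_real_inner_le_norm u d
  obtain ⟨h₁, h₂⟩ := abs_le.mp habs
  have hle := le_of_even_of_lt hγeven hγlt h₁ h₂
  have hd' := h d hd
  have hu' := h u hu
  rw [real_inner_self_eq_norm_sq, hd, one_pow] at hd'
  rw [real_inner_self_eq_norm_sq, hu, one_pow, real_inner_comm] at hu'
  have hrs : s = r := by
    refine le_antisymm ?_ ?_ <;> refine le_of_mul_le_mul_right ?_ hγ1
    · exact hu' ▸ mul_le_mul_of_nonneg_left hle hr.le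
    · exact hd' ▸ mul_le_mul_of_nonneg_left hle hs.le
  refine ⟨hrs, ?_⟩
  have heq : γ ⟪u, d⟫ = γ 1 := by
    subst hrs
    exact (mul_left_cancel₀ hs.ne' hd').symm
  rcases h₁.eq_or_lt with h₁ | h₁
  · exact Or.inr ((inner_eq_neg_one_iff_of_norm_eq_one hu hd).mp h₁.symm)
  rcases h₂.eq_or_lt with h₂ | h₂
  · exact Or.inl ((inner_eq_one_iff_of_norm_eq_one hu hd).mp h₂)
  · exact absurd heq (hγlt _ h₁ h₂).ne

/-- with `ρ`, `γ` continuous, positive semidefinite kernel, `C₀`-universal `ρ`,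
`γ` even with `γ(1) > 0` and `γ(u) < γ(1)` on `(-1,1)`, the kernel norm induces a metric on
`𝒟̊` modulo orientation: `Q(μ-μ') = 0` forces the atoms of `μ` and `μ'` to coincide up to a
permutation and orientation flips of the directions. -/
theorem stmt2 (n : ℕ) (hn : 1 ≤ n) (ρ γ : ℝ → ℝ)
    (hρc : Continuous ρ) (hγc : Continuous γ)
    (hpsd : ∀ (P : ℕ) (a : Fin P → Euc n × Euc n) (c : Fin P → ℝ),
        (∀ i, ‖(a i).2‖ = 1) → Function.Injective a → 0 ≤ QformF ρ γ a c)
    (huniv₁ : ∀ y : Euc n, ∃ g : ZeroAtInftyContinuousMap (Euc n) ℝ,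
        ∀ x : Euc n, g x = ρ (‖x - y‖ ^ 2))
    (huniv₂ : Dense (X := ZeroAtInftyContinuousMap (Euc n) ℝ)
        (Submodule.span ℝ {g : ZeroAtInftyContinuousMap (Euc n) ℝ |
            ∃ y : Euc n, ∀ x : Euc n, g x = ρ (‖x - y‖ ^ 2)} : Set _))
    (hγeven : ∀ u : ℝ, -1 ≤ u → u ≤ 1 → γ (-u) = γ u)
    (hγ1 : 0 < γ 1) (hγlt : ∀ u : ℝ, -1 < u → u < 1 → γ u < γ 1)
    -- the two discrete varifolds `μ = Σ rᵢ δ_{(xᵢ,dᵢ)}` and `μ' = Σ rⱼ' δ_{(yⱼ,uⱼ)}` in `𝒟̊`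
    (N M : ℕ) (x : Fin N → Euc n) (d : Fin N → Euc n) (r : Fin N → ℝ)
    (y : Fin M → Euc n) (u : Fin M → Euc n) (s : Fin M → ℝ)
    (hx : Function.Injective x) (hy : Function.Injective y)
    (hd : ∀ i, ‖d i‖ = 1) (hu : ∀ j, ‖u j‖ = 1)
    (hr : ∀ i, 0 < r i) (hs : ∀ j, 0 < s j)
    -- `Q(μ - μ') = 0`
    (hQ : QformF ρ γ (Sum.elim (fun i => (x i, d i)) (fun j => (y j, u j)))
        (Sum.elim r (fun j => -(s j))) = 0) :
    ∃ σ : Fin N ≃ Fin M, ∀ i : Fin N,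
      y (σ i) = x i ∧ s (σ i) = r i ∧ (u (σ i) = d i ∨ u (σ i) = -(d i)) := by
  have hbal (z e : Euc n) (he : ‖e‖ = 1) :
      ∑ i, Set.indicator {z} (fun _ => r i * γ ⟪d i, e⟫) (x i) =
        ∑ j, Set.indicator {z} (fun _ => s j * γ ⟪u j, e⟫) (y j) := by
    have h := sum_indicator_eq_zero_of_universal huniv₂ (Sum.elim x y)
      (Sum.elim (fun i => r i * γ ⟪d i, e⟫) (fun j => -(s j * γ ⟪u j, e⟫))) (fun p => by
        rw [← sum_mul_kerF_eq_zero hpsd _ _ (by rintro (i | j) <;> simp [hd, hu]) hQ (p, e) he]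
        refine Finset.sum_congr rfl ?_
        rintro (i | j) - <;> simp only [Sum.elim_inl, Sum.elim_inr, kerF] <;> ring) z
    simp only [Fintype.sum_sum_type, Sum.elim_inl, Sum.elim_inr] at h
    rw [← sub_eq_zero, ← h, sub_eq_add_neg, ← Finset.sum_neg_distrib]
    refine congrArg _ (Finset.sum_congr rfl fun j _ => ?_)
    by_cases hj : y j = z <;> simp [hj]
  have hleft (i : Fin N) (e : Euc n) :
      ∑ k, Set.indicator {x i} (fun _ => r k * γ ⟪d k, e⟫) (x k) = r i * γ ⟪d i, e⟫ := by
    simp [Set.indicator_apply, hx.eq_iff]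
  have hright (j : Fin M) (e : Euc n) :
      ∑ k, Set.indicator {y j} (fun _ => s k * γ ⟪u k, e⟫) (y k) = s j * γ ⟪u j, e⟫ := by
    simp [Set.indicator_apply, hy.eq_iff]
  have hexl (i : Fin N) : ∃ j, y j = x i := by
    by_contra! hne
    have h := hbal (x i) (d i) (hd i)
    rw [hleft, Finset.sum_eq_zero fun j _ => Set.indicator_of_notMem (s := {x i}) (hne j) _,
      real_inner_self_eq_norm_sq, hd, one_pow] at h
    exact (mul_pos (hr i) hγ1).ne' h
  have hexr (j : Fin M) : ∃ i, x i = y j := by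
    by_contra! hne
    have h := hbal (y j) (u j) (hu j)
    rw [hright, Finset.sum_eq_zero fun i _ => Set.indicator_of_notMem (s := {y j}) (hne i) _,
      real_inner_self_eq_norm_sq, hu, one_pow] at h
    exact (mul_pos (hs j) hγ1).ne h
  choose f hf using hexl
  refine ⟨Equiv.ofBijective f ⟨fun i k hik => hx ?_, fun j => ?_⟩, fun i => ⟨hf i, ?_⟩⟩
  · rw [← hf, hik, hf]
  · obtain ⟨i, hi⟩ := hexr j
    exact ⟨i, hy ((hf i).trans hi)⟩
  · refine eq_weight_and_axis (u := u (f i)) (s := s (f i)) hγeven hγ1 hγlt (hd i) (hu _) (hr i)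
      (hs _) fun e he => ?_
    rw [← hleft, hbal _ _ he, ← hf, hright]
end
end

section
/- Let n ≥ 2 and N ≥ 1, and let μ = Σ_{i=1}^N r_i δ_{(x_i,d_i)} and ν = Σ_{i=1}^N s_i δ_{(y_i,u_i)} be two discrete varifolds with pairwise distinct positions (x_i pairwise distinct, y_i pairwise distinct), unit directions d_i, u_i ∈ S^{n−1} and weights r_i, s_i > 0. Then there exists a C^∞ diffeomorphism φ of ℝⁿ with φ_* μ = ν if and only if there exists a permutation σ of {1,…,N} such that s_{σ(i)} = r_i for all i. In other words, under the normalized action the orbits in the space of discrete varifolds with one direction per distinct position are entirely determined by the multiset of weights. -/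
noncomputable section

/-- A `C^∞` diffeomorphism of `ℝⁿ`: a smooth bijection with smooth inverse. -/
def IsSmoothDiffeo {n : ℕ} (φ : Euc n → Euc n) : Prop :=
  ContDiff ℝ (⊤ : ℕ∞) φ ∧ ∃ φinv : Euc n → Euc n, ContDiff ℝ (⊤ : ℕ∞) φinv ∧
    Function.LeftInverse φinv φ ∧ Function.RightInverse φinv φ

theorem IsSmoothDiffeo.comp {n : ℕ} {φ ψ : Euc n → Euc n} (hφ : IsSmoothDiffeo φ)
    (hψ : IsSmoothDiffeo ψ) : IsSmoothDiffeo (φ ∘ ψ) := by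
  obtain ⟨hφs, φ', hφ's, hφl, hφr⟩ := hφ
  obtain ⟨hψs, ψ', hψ's, hψl, hψr⟩ := hψ
  exact ⟨hφs.comp hψs, ψ' ∘ φ', hψ's.comp hφ's, hφl.comp hψl, hφr.comp hψr⟩

theorem IsSmoothDiffeo.differentiable {n : ℕ} {φ : Euc n → Euc n} (hφ : IsSmoothDiffeo φ) :
    Differentiable ℝ φ :=
  hφ.1.differentiable (by simp)

/-- `φ` carries the atoms `(x i, d i)` to `(y i, u i)`, with the transported directions
equal to `u i` before any normalization. -/
def Transports {n : ℕ} {ι : Type*} (φ : Euc n → Euc n) (x d y u : ι → Euc n) : Prop :=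
  IsSmoothDiffeo φ ∧ ∀ i, φ (x i) = y i ∧ fderiv ℝ φ (x i) (d i) = u i

theorem Transports.comp {n : ℕ} {ι : Type*} {φ ψ : Euc n → Euc n} {x d y u z v : ι → Euc n}
    (hψ : Transports ψ y u z v) (hφ : Transports φ x d y u) : Transports (ψ ∘ φ) x d z v := by
  refine ⟨hψ.1.comp hφ.1, fun i => ⟨?_, ?_⟩⟩
  · simp [(hφ.2 i).1, (hψ.2 i).1]
  · rw [fderiv_comp _ (hψ.1.differentiable _) (hφ.1.differentiable _)]
    simp [(hφ.2 i).1, (hφ.2 i).2, (hψ.2 i).2]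

theorem Transports.exists_symm {n : ℕ} {ι : Type*} {φ : Euc n → Euc n} {x d y u : ι → Euc n}
    (hφ : Transports φ x d y u) : ∃ ψ, Transports ψ y u x d := by
  obtain ⟨⟨hs, ψ, hψs, hl, hr⟩, h⟩ := hφ
  have hψ : IsSmoothDiffeo ψ := ⟨hψs, φ, hs, hr, hl⟩
  refine ⟨ψ, hψ, fun i => ⟨by rw [← (h i).1, hl], ?_⟩⟩
  have hφ : IsSmoothDiffeo φ := ⟨hs, ψ, hψs, hl, hr⟩
  have hcomp := fderiv_comp (x i) (hψ.differentiable (φ (x i))) (hφ.differentiable (x i))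
  rw [hl.comp_eq_id, fderiv_id, (h i).1] at hcomp
  have := congrArg (fun L => L (d i)) hcomp
  simpa [(h i).2] using this.symm

/-- Hermite interpolation of values and first derivatives by a smooth curve in a subspace. -/
theorem exists_contDiff_hermite {E : Type*} [NormedAddCommGroup E] [NormedSpace ℝ E]
    {ι : Type*} [Fintype ι] (K : Submodule ℝ E) {t : ι → ℝ} (ht : Function.Injective t)
    {a b : ι → E} (ha : ∀ i, a i ∈ K) (hb : ∀ i, b i ∈ K) :
    ∃ F : ℝ → E, ContDiff ℝ (⊤ : ℕ∞) F ∧ (∀ z, F z ∈ K) ∧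
      ∀ i, F (t i) = a i ∧ HasDerivAt F (b i) (t i) := by
  classical
  have hbump : ∀ i, ∃ h : ℝ → ℝ, ContDiff ℝ (⊤ : ℕ∞) h ∧
      (∀ j, h (t j) = if j = i then 1 else 0) ∧ ∀ j, HasDerivAt h 0 (t j) := by
    intro i
    have hnhds : (t '' {j | j ≠ i})ᶜ ∈ nhds (t i) := by
      refine (Set.toFinite _).isClosed.isOpen_compl.mem_nhds ?_
      rintro ⟨j, hj, hji⟩
      exact hj (ht hji)
    obtain ⟨h, hsupp, -, hsmooth, hrange, hone⟩ :=
      exists_contDiff_tsupport_subset (n := ⊤) hnhds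
    have hval : ∀ j, h (t j) = if j = i then 1 else 0 := by
      intro j
      split_ifs with hj
      · rw [hj, hone]
      · exact image_eq_zero_of_notMem_tsupport fun hmem => hsupp hmem ⟨j, hj, rfl⟩
    have hmem : ∀ z, h z ∈ Set.Icc (0 : ℝ) 1 := fun z => hrange ⟨z, rfl⟩
    refine ⟨h, hsmooth, hval, fun j => ?_⟩
    have hderiv : deriv h (t j) = 0 := by
      by_cases hj : j = i
      · refine IsLocalMax.deriv_eq_zero (Filter.Eventually.of_forall fun z => ?_)
        simpa [hval, hj] using (hmem z).2
      · refine IsLocalMin.deriv_eq_zero (Filter.Eventually.of_forall fun z => ?_)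
        simpa [hval, hj] using (hmem z).1
    rw [← hderiv]
    exact (hsmooth.differentiable (by simp) _).hasDerivAt
  choose h hsmooth hval hderiv using hbump
  refine ⟨fun z => ∑ i, h i z • (a i + (z - t i) • b i), ?_, fun z => ?_, fun j => ⟨?_, ?_⟩⟩
  · have := hsmooth
    fun_prop
  · exact K.sum_mem fun i _ => K.smul_mem _ (K.add_mem (ha i) (K.smul_mem _ (hb i)))
  · simp [hval, Finset.sum_add_distrib]
  · have hline : ∀ i, HasDerivAt (fun z => a i + (z - t i) • b i) (b i) (t j) := fun i => by
      simpa using (((hasDerivAt_id (t j)).sub_const (t i)).smul_const (b i)).const_add (a i)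
    have := HasDerivAt.fun_sum (u := Finset.univ) fun i _ => (hderiv i j).smul (hline i)
    simpa [hval] using this

/-- Shearing along `ker l` reaches any configuration with the same images under `l`. -/
theorem exists_transports_of_dual_eq {n : ℕ} {ι : Type*} [Fintype ι] (l : Euc n →L[ℝ] ℝ)
    {x d y u : ι → Euc n} (hx : Function.Injective fun i => l (x i)) (hd : ∀ i, l (d i) ≠ 0)
    (hxy : ∀ i, l (y i) = l (x i)) (hdu : ∀ i, l (u i) = l (d i)) :
    ∃ φ, Transports φ x d y u := by
  obtain ⟨F, hF, hker, hval⟩ := exists_contDiff_hermite l.ker hx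
    (a := fun i => y i - x i) (b := fun i => (l (d i))⁻¹ • (u i - d i))
    (fun i => by simp [hxy]) (fun i => by simp [hdu])
  have hlF : ∀ z, l (F z) = 0 := hker
  refine ⟨fun z => z + F (l z), ⟨by fun_prop, fun z => z - F (l z), by fun_prop,
    fun z => by simp [hlF], fun z => by simp [hlF]⟩, fun i => ⟨by simp [(hval i).1], ?_⟩⟩
  have hderiv : HasFDerivAt (fun z => z + F (l z)) _ (x i) :=
    (hasFDerivAt_id (x i)).add ((hval i).2.hasFDerivAt.comp (x i) l.hasFDerivAt)
  rw [hderiv.fderiv]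
  simp [smul_smul, hd i]

/-- Two shears bring every configuration in general position to a standard one. -/
theorem exists_transports_standard {n N : ℕ} {l m : Euc n →L[ℝ] ℝ} {f : Euc n}
    (hl : l f = 0) (hm : m f = 1) {x d : Fin N → Euc n}
    (hx : Function.Injective fun i => l (x i)) (hd : ∀ i, l (d i) ≠ 0) :
    ∃ φ, Transports φ x d (fun i => (i : ℝ) • f) fun _ => f := by
  obtain ⟨φ, hφ⟩ := exists_transports_of_dual_eq l hx hd
    (y := fun i => x i + ((i : ℝ) - m (x i)) • f) (u := fun i => d i + (1 - m (d i)) • f)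
    (by simp [hl]) (by simp [hl])
  obtain ⟨ψ, hψ⟩ := exists_transports_of_dual_eq m
    (x := fun i => x i + ((i : ℝ) - m (x i)) • f) (d := fun i => d i + (1 - m (d i)) • f)
    (y := fun i : Fin N => (i : ℝ) • f) (u := fun _ => f)
    (fun i j hij => by simpa [hm, Fin.val_inj] using hij) (by simp [hm]) (by simp [hm])
    (by simp [hm])
  exact ⟨ψ ∘ φ, hψ.comp hφ⟩

/-- In dimension at least two, configurations of points with nonzero directions are all
equivalent under smooth diffeomorphisms. -/
theorem exists_transports {n N : ℕ} (hn : 2 ≤ n) {x d y u : Fin N → Euc n}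
    (hx : Function.Injective x) (hy : Function.Injective y) (hd : ∀ i, d i ≠ 0)
    (hu : ∀ i, u i ≠ 0) : ∃ φ, Transports φ x d y u := by
  obtain ⟨l₀, hl₀⟩ := Module.exists_dual_forall_apply_ne_zero (K := ℝ)
    (Sum.elim (Sum.elim d u) (Sum.elim
      (fun p : {p : Fin N × Fin N // p.1 ≠ p.2} => x p.1.1 - x p.1.2)
      (fun p : {p : Fin N × Fin N // p.1 ≠ p.2} => y p.1.1 - y p.1.2)))
    (by
      rintro ((i | i) | (⟨p, hp⟩ | ⟨p, hp⟩))
      exacts [hd i, hu i, sub_ne_zero.2 (hx.ne hp), sub_ne_zero.2 (hy.ne hp)])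
  simp only [Sum.forall, Sum.elim_inl, Sum.elim_inr, Subtype.forall, Prod.forall, map_sub,
    sub_ne_zero] at hl₀
  obtain ⟨⟨hld, hlu⟩, hlx, hly⟩ := hl₀
  obtain ⟨f, hlf, hf⟩ := (Submodule.ne_bot_iff _).1
    (LinearMap.ker_ne_bot_of_finrank_lt (f := l₀) (by simp; omega))
  obtain ⟨m, hm⟩ := SeparatingDual.exists_eq_one (R := ℝ) hf
  obtain ⟨φ, hφ⟩ := exists_transports_standard (l := l₀.toContinuousLinearMap) hlf hm
    (x := x) (d := d) (fun i j hij => by_contra fun hne => hlx i j hne hij) hld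
  obtain ⟨ψ, hψ⟩ := exists_transports_standard (l := l₀.toContinuousLinearMap) hlf hm
    (x := y) (d := u) (fun i j hij => by_contra fun hne => hly i j hne hij) hlu
  obtain ⟨χ, hχ⟩ := hψ.exists_symm
  exact ⟨χ ∘ φ, hχ.comp hφ⟩

/-- for `n ≥ 2` and discrete varifolds `μ = Σ rᵢ δ_{(xᵢ,dᵢ)}`,
`ν = Σ sᵢ δ_{(yᵢ,uᵢ)}` with pairwise distinct positions and one unit direction per position,
there is a `C^∞` diffeomorphism `φ` with `φ_* μ = ν` (equality of varifolds, i.e. the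
transported atoms of `μ` match the atoms of `ν` up to a permutation) if and only if there is
a permutation `σ` with `s_{σ(i)} = rᵢ` for all `i`: under the normalized action the orbits
are determined by the multiset of weights. -/
theorem stmt10 (n N : ℕ) (hn : 2 ≤ n) (hN : 1 ≤ N)
    (x y : Fin N → Euc n) (hx : Function.Injective x) (hy : Function.Injective y)
    (d u : Fin N → Euc n) (hd : ∀ i, ‖d i‖ = 1) (hu : ∀ i, ‖u i‖ = 1)
    (r s : Fin N → ℝ) (hr : ∀ i, 0 < r i) (hs : ∀ i, 0 < s i) :
    (∃ φ : Euc n → Euc n, IsSmoothDiffeo φ ∧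
        ∃ τ : Equiv.Perm (Fin N), ∀ i,
          φ (x i) = y (τ i) ∧
          ‖fderiv ℝ φ (x i) (d i)‖⁻¹ • fderiv ℝ φ (x i) (d i) = u (τ i) ∧
          s (τ i) = r i) ↔
      (∃ σ : Equiv.Perm (Fin N), ∀ i, s (σ i) = r i) := by
  constructor
  · rintro ⟨_, _, τ, hτ⟩
    exact ⟨τ, fun i => (hτ i).2.2⟩
  · rintro ⟨σ, hσ⟩
    have hne : ∀ v : Euc n, ‖v‖ = 1 → v ≠ 0 := fun v hv => norm_ne_zero_iff.1 (by simp [hv])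
    obtain ⟨φ, hφ, h⟩ := exists_transports hn hx (hy.comp σ.injective)
      (fun i => hne _ (hd i)) (u := u ∘ σ) (fun i => hne _ (hu (σ i)))
    exact ⟨φ, hφ, σ, fun i => ⟨(h i).1, by simp [(h i).2, hu], hσ i⟩⟩
end
end

section
/- (Converse direction of the reduction proposition.) Let (x_i, d_i, r_i, p_i^{(1)}, p_i^{(2)}, p_i^{(3)})_{i=1,…,P} : [0,1] → ℝⁿ × S^{n−1} × ℝ_{>0} × ℝⁿ × ℝⁿ × ℝ be a C¹ solution of the full Hamiltonian system whose initial conditions satisfy ⟨p_i^{(2)}(0), d_i(0)⟩ = r_i(0) p_i^{(3)}(0) for every i. Then the curves defined by x_i(t), u_i(t) := r_i(t) d_i(t), P_i^{(1)}(t) := p_i^{(1)}(t), P_i^{(2)}(t) := p_i^{(2)}(t)/r_i(t) form a solution of the reduced Hamiltonian system; in particular ⟨p_i^{(2)}(t), d_i(t)⟩ = r_i(t) p_i^{(3)}(t) for all t ∈ [0,1] and the vector field v_t of the full system coincides with the vector field V_t of the reduced system. -/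
open scoped RealInnerProductSpace

noncomputable section

/-- Orthogonal projection `P_{e⊥}(w) = w - ⟨w,e⟩e` onto the hyperplane orthogonal to the
unit vector `e`. -/
def projPerp {n : ℕ} (e w : Euc n) : Euc n := w - ⟪w, e⟫ • e

/-- `D₁K(x,y)(u₁,u₂)`: derivative at `x`, in the direction `u₁`, of `z ↦ K(z,y)u₂`. -/
def D1K {n : ℕ} (K : Euc n → Euc n → (Euc n →L[ℝ] Euc n)) (x y u₁ u₂ : Euc n) : Euc n :=
  fderiv ℝ (fun z => K z y u₂) x u₁

/-- `(D_x f)^T`, the transpose (Euclidean adjoint) of the Jacobian of `f` at `x`. -/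
def DxT {n : ℕ} (f : Euc n → Euc n) (x : Euc n) : Euc n →L[ℝ] Euc n :=
  ContinuousLinearMap.adjoint (fderiv ℝ f x)

/-- `(D²_x f(·,u))^T`, the transpose of the derivative at `x` of `z ↦ D_z f(u)`. -/
def D2T {n : ℕ} (f : Euc n → Euc n) (x u : Euc n) : Euc n →L[ℝ] Euc n :=
  ContinuousLinearMap.adjoint (fderiv ℝ (fun z => fderiv ℝ f z u) x)

/-- The vector field of the REDUCED Hamiltonian system:
`V_t(z) = Σ_k K(x_k(t),z) P¹_k(t) + D₁K(x_k(t),z)(u_k(t), P²_k(t))`. -/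
def Vred {n : ℕ} (P : ℕ) (K : Euc n → Euc n → (Euc n →L[ℝ] Euc n))
    (x u P1 P2 : Fin P → ℝ → Euc n) (t : ℝ) (z : Euc n) : Euc n :=
  ∑ k, (K (x k t) z (P1 k t) + D1K K (x k t) z (u k t) (P2 k t))

/-- The vector field of the FULL Hamiltonian system:
`v_t(z) = Σ_k K(x_k(t),z) p¹_k(t)
  + D₁K(x_k(t),z)(d_k(t), P_{d_k⊥}(p²_k(t)) + p³_k(t) r_k(t) d_k(t))`. -/
def vfull {n : ℕ} (P : ℕ) (K : Euc n → Euc n → (Euc n →L[ℝ] Euc n))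
    (x d : Fin P → ℝ → Euc n) (r : Fin P → ℝ → ℝ)
    (p1 p2 : Fin P → ℝ → Euc n) (p3 : Fin P → ℝ → ℝ) (t : ℝ) (z : Euc n) : Euc n :=
  ∑ k, (K (x k t) z (p1 k t)
    + D1K K (x k t) z (d k t) (projPerp (d k t) (p2 k t) + (p3 k t * r k t) • d k t))

theorem D1K_smul_smul {n : ℕ} (K : Euc n → Euc n → (Euc n →L[ℝ] Euc n)) (x y u w : Euc n)
    (a b : ℝ) : D1K K x y (a • u) (b • w) = (a * b) • D1K K x y u w := by
  have h : (fun z => K z y (b • w)) = b • fun z => K z y w := by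
    funext z
    simp
  rw [D1K, h, fderiv_const_smul_field, map_smul, Pi.smul_apply, smul_apply, smul_smul, D1K]

theorem D2T_smul_smul {n : ℕ} (f : Euc n → Euc n) (x u w : Euc n) (a b : ℝ) :
    D2T f x (a • u) (b • w) = (a * b) • D2T f x u w := by
  have h : (fun z => fderiv ℝ f z (a • u)) = a • fun z => fderiv ℝ f z u := by
    funext z
    simp
  rw [D2T, h, fderiv_const_smul_field, map_smul, Pi.smul_apply, map_smulₛₗ, smul_apply,
    smul_smul, conj_trivial, mul_comm b, D2T]

/-- The defect `c = ⟨d, q⟩ - r s` of the compatibility condition satisfies `c' = 2⟨d, Ad⟩c`, while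
`r' = ⟨d, Ad⟩r`; hence `c / r²` is stationary. -/
theorem hasDerivAt_compatibility_defect {n : ℕ} {d q : ℝ → Euc n} {r s : ℝ → ℝ} {t : ℝ}
    (A : Euc n →L[ℝ] Euc n) (hr : r t ≠ 0)
    (hd' : HasDerivAt d (projPerp (d t) (A (d t))) t)
    (hr' : HasDerivAt r (r t * ⟪d t, A (d t)⟫) t)
    (hq' : HasDerivAt q
      (-(ContinuousLinearMap.adjoint A (q t))
        + (⟪d t, q t⟫ - r t * s t) • (A (d t) + ContinuousLinearMap.adjoint A (d t))
        + ⟪d t, A (d t)⟫ • q t) t)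
    (hs' : HasDerivAt s (-(s t * ⟪d t, A (d t)⟫)) t) :
    HasDerivAt (fun τ => (⟪d τ, q τ⟫ - r τ * s τ) / r τ ^ 2) 0 t := by
  refine (((hd'.inner ℝ hq').sub (hr'.mul hs')).div (hr'.pow 2)
    (pow_ne_zero 2 hr)).congr_deriv ?_
  simp only [projPerp, inner_add_right, inner_sub_left, inner_neg_right, inner_smul_left,
    inner_smul_right, ContinuousLinearMap.adjoint_inner_right, conj_trivial, Pi.sub_apply,
    Pi.mul_apply, Pi.pow_apply, real_inner_comm (d t) (A (d t))]
  field_simp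
  ring

/-- The compatibility condition `⟨q, d⟩ = r s` propagates from the initial time. -/
theorem inner_eq_mul_of_initial {n : ℕ} {d q : ℝ → Euc n} {r s : ℝ → ℝ}
    (A : ℝ → Euc n →L[ℝ] Euc n)
    (hr : ∀ t ∈ Set.Icc (0:ℝ) 1, 0 < r t)
    (hd' : ∀ t ∈ Set.Icc (0:ℝ) 1, HasDerivAt d (projPerp (d t) (A t (d t))) t)
    (hr' : ∀ t ∈ Set.Icc (0:ℝ) 1, HasDerivAt r (r t * ⟪d t, A t (d t)⟫) t)
    (hq' : ∀ t ∈ Set.Icc (0:ℝ) 1, HasDerivAt q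
      (-(ContinuousLinearMap.adjoint (A t) (q t))
        + (⟪d t, q t⟫ - r t * s t) • (A t (d t) + ContinuousLinearMap.adjoint (A t) (d t))
        + ⟪d t, A t (d t)⟫ • q t) t)
    (hs' : ∀ t ∈ Set.Icc (0:ℝ) 1, HasDerivAt s (-(s t * ⟪d t, A t (d t)⟫)) t)
    (h0 : ⟪q 0, d 0⟫ = r 0 * s 0) {t : ℝ} (ht : t ∈ Set.Icc (0:ℝ) 1) :
    ⟪q t, d t⟫ = r t * s t := by
  have hder : ∀ τ ∈ Set.Icc (0:ℝ) 1,
      HasDerivAt (fun τ => (⟪d τ, q τ⟫ - r τ * s τ) / r τ ^ 2) 0 τ := fun τ hτ =>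
    hasDerivAt_compatibility_defect (A τ) (hr τ hτ).ne' (hd' τ hτ) (hr' τ hτ)
      (hq' τ hτ) (hs' τ hτ)
  have hconst := constant_of_has_deriv_right_zero
    (fun τ hτ => (hder τ hτ).continuousAt.continuousWithinAt)
    (fun τ hτ => (hder τ (Set.Ico_subset_Icc_self hτ)).hasDerivWithinAt) t ht
  have hrt := (hr t ht).ne'
  rw [real_inner_comm (q 0) (d 0), h0, sub_self, zero_div, div_eq_zero_iff] at hconst
  rw [real_inner_comm]
  exact sub_eq_zero.mp (hconst.resolve_right (pow_ne_zero 2 hrt))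

/-- converse direction of the reduction proposition: any solution of the
full Hamiltonian system whose initial conditions satisfy `⟨p²_i(0), d_i(0)⟩ = r_i(0) p³_i(0)`
gives, via `u_i = r_i d_i`, `P¹_i = p¹_i`, `P²_i = p²_i / r_i`, a solution of the reduced
Hamiltonian system; in particular `⟨p²_i(t), d_i(t)⟩ = r_i(t) p³_i(t)` for all `t` and the
full vector field coincides with the reduced one. -/
theorem stmt17 (n P : ℕ) (hn : 1 ≤ n) (hP : 1 ≤ P)
    (K : Euc n → Euc n → (Euc n →L[ℝ] Euc n))
    (hK : ContDiff ℝ 2 (fun q : Euc n × Euc n => K q.1 q.2))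
    (x d p1 p2 : Fin P → ℝ → Euc n) (r p3 : Fin P → ℝ → ℝ)
    (hC1 : ∀ i, ContDiffOn ℝ 1 (x i) (Set.Icc (0:ℝ) 1) ∧
      ContDiffOn ℝ 1 (d i) (Set.Icc (0:ℝ) 1) ∧
      ContDiffOn ℝ 1 (r i) (Set.Icc (0:ℝ) 1) ∧
      ContDiffOn ℝ 1 (p1 i) (Set.Icc (0:ℝ) 1) ∧
      ContDiffOn ℝ 1 (p2 i) (Set.Icc (0:ℝ) 1) ∧
      ContDiffOn ℝ 1 (p3 i) (Set.Icc (0:ℝ) 1))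
    (hd : ∀ i, ∀ t ∈ Set.Icc (0:ℝ) 1, ‖d i t‖ = 1)
    (hr : ∀ i, ∀ t ∈ Set.Icc (0:ℝ) 1, 0 < r i t)
    -- the full Hamiltonian system
    (hx : ∀ i, ∀ t ∈ Set.Icc (0:ℝ) 1,
        HasDerivAt (x i) (vfull P K x d r p1 p2 p3 t (x i t)) t)
    (hdd : ∀ i, ∀ t ∈ Set.Icc (0:ℝ) 1,
        HasDerivAt (d i)
          (projPerp (d i t) (fderiv ℝ (vfull P K x d r p1 p2 p3 t) (x i t) (d i t))) t)
    (hrd : ∀ i, ∀ t ∈ Set.Icc (0:ℝ) 1,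
        HasDerivAt (r i)
          (r i t * ⟪d i t, fderiv ℝ (vfull P K x d r p1 p2 p3 t) (x i t) (d i t)⟫) t)
    (hp1 : ∀ i, ∀ t ∈ Set.Icc (0:ℝ) 1,
        HasDerivAt (p1 i)
          (-(DxT (vfull P K x d r p1 p2 p3 t) (x i t) (p1 i t))
            - D2T (vfull P K x d r p1 p2 p3 t) (x i t) (d i t)
                (projPerp (d i t) (p2 i t))
            - (p3 i t * r i t)
                • D2T (vfull P K x d r p1 p2 p3 t) (x i t) (d i t) (d i t)) t)
    (hp2 : ∀ i, ∀ t ∈ Set.Icc (0:ℝ) 1,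
        HasDerivAt (p2 i)
          (-(DxT (vfull P K x d r p1 p2 p3 t) (x i t) (p2 i t))
            + (⟪d i t, p2 i t⟫ - r i t * p3 i t)
                • (fderiv ℝ (vfull P K x d r p1 p2 p3 t) (x i t) (d i t)
                    + DxT (vfull P K x d r p1 p2 p3 t) (x i t) (d i t))
            + ⟪d i t, fderiv ℝ (vfull P K x d r p1 p2 p3 t) (x i t) (d i t)⟫
                • p2 i t) t)
    (hp3 : ∀ i, ∀ t ∈ Set.Icc (0:ℝ) 1,
        HasDerivAt (p3 i)
          (-(p3 i t
            * ⟪d i t, fderiv ℝ (vfull P K x d r p1 p2 p3 t) (x i t) (d i t)⟫)) t)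
    -- compatibility of the initial conditions
    (hinit : ∀ i, ⟪p2 i 0, d i 0⟫ = r i 0 * p3 i 0) :
    let u : Fin P → ℝ → Euc n := fun i t => r i t • d i t
    let Q2 : Fin P → ℝ → Euc n := fun i t => (r i t)⁻¹ • p2 i t
    (∀ t ∈ Set.Icc (0:ℝ) 1, ∀ z : Euc n,
        vfull P K x d r p1 p2 p3 t z = Vred P K x u p1 Q2 t z) ∧
      (∀ i, ∀ t ∈ Set.Icc (0:ℝ) 1, ⟪p2 i t, d i t⟫ = r i t * p3 i t) ∧
      ∀ i, ∀ t ∈ Set.Icc (0:ℝ) 1,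
        HasDerivAt (x i) (Vred P K x u p1 Q2 t (x i t)) t ∧
        HasDerivAt (u i) (fderiv ℝ (Vred P K x u p1 Q2 t) (x i t) (u i t)) t ∧
        HasDerivAt (p1 i)
          (-(DxT (Vred P K x u p1 Q2 t) (x i t) (p1 i t))
            - D2T (Vred P K x u p1 Q2 t) (x i t) (u i t) (Q2 i t)) t ∧
        HasDerivAt (Q2 i) (-(DxT (Vred P K x u p1 Q2 t) (x i t) (Q2 i t))) t := by
  intro u Q2
  have hcompat : ∀ i, ∀ t ∈ Set.Icc (0:ℝ) 1, ⟪p2 i t, d i t⟫ = r i t * p3 i t := fun i t ht =>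
    inner_eq_mul_of_initial (fun t => fderiv ℝ (vfull P K x d r p1 p2 p3 t) (x i t))
      (hr i) (hdd i) (hrd i) (hp2 i) (hp3 i) (hinit i) ht
  have hproj : ∀ i, ∀ t ∈ Set.Icc (0:ℝ) 1,
      projPerp (d i t) (p2 i t) + (p3 i t * r i t) • d i t = p2 i t := fun i t ht => by
    rw [projPerp, hcompat i t ht, mul_comm (r i t), sub_add_cancel]
  have hv : ∀ t ∈ Set.Icc (0:ℝ) 1,
      vfull P K x d r p1 p2 p3 t = Vred P K x u p1 Q2 t := fun t ht => by
    funext z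
    refine Finset.sum_congr rfl fun k _ => ?_
    rw [hproj k t ht, D1K_smul_smul, mul_inv_cancel₀ (hr k t ht).ne', one_smul]
  refine ⟨fun t ht z => congrFun (hv t ht) z, hcompat, fun i t ht => ?_⟩
  have hrt : r i t ≠ 0 := (hr i t ht).ne'
  rw [← hv t ht]
  refine ⟨hx i t ht, ?_, ?_, ?_⟩
  · refine ((hrd i t ht).smul (hdd i t ht)).congr_deriv ?_
    simp only [u, projPerp, map_smul, real_inner_comm (d i t)]
    module
  · refine (hp1 i t ht).congr_deriv ?_
    rw [D2T_smul_smul, mul_inv_cancel₀ hrt, one_smul, sub_sub, ← map_smul, ← map_add,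
      hproj i t ht]
  · refine (((hrd i t ht).inv hrt).smul (hp2 i t ht)).congr_deriv ?_
    have hc : ⟪d i t, p2 i t⟫ - r i t * p3 i t = 0 := by
      rw [real_inner_comm, hcompat i t ht, sub_self]
    simp only [Q2, hc, map_smul, Pi.inv_apply]
    match_scalars <;> field_simp <;> ring
end
end
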